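/- Let λ ∈ h* satisfy λ(z) ≠ 0 and λ(h) ∉ (1/2)ℤ. Then the Verma module Δ(λ) is a simple U-module. -/

import Mathlib

namespace Schrodinger

noncomputable section

open scoped TensorProduct

/-- Generators of the Schrödinger algebra. -/
inductive Gen : Type
  | E | H | F | P | Q | Z
  deriving DecidableEq

/-- The free algebra on the generators. -/
abbrev FA : Type := FreeAlgebra ℂ Gen

/-- Inclusion of generators. -/
def ιg (g : Gen) : FA := FreeAlgebra.ι ℂ g

/-- The defining relations of the universal enveloping algebra of the Schrödinger
algebra `s`: `z` is central and `[h,e]=2e`, `[e,f]=h`, `[h,f]=-2f`, `[e,q]=p`,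
`[e,p]=0`, `[h,p]=p`, `[f,p]=q`, `[f,q]=0`, `[h,q]=-q`, `[p,q]=z`. -/
inductive Rel : FA → FA → Prop
  | he : Rel (ιg .H * ιg .E) (ιg .E * ιg .H + 2 * ιg .E)
  | ef : Rel (ιg .E * ιg .F) (ιg .F * ιg .E + ιg .H)
  | hf : Rel (ιg .H * ιg .F) (ιg .F * ιg .H - 2 * ιg .F)
  | eq : Rel (ιg .E * ιg .Q) (ιg .Q * ιg .E + ιg .P)
  | ep : Rel (ιg .E * ιg .P) (ιg .P * ιg .E)
  | hp : Rel (ιg .H * ιg .P) (ιg .P * ιg .H + ιg .P)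
  | fp : Rel (ιg .F * ιg .P) (ιg .P * ιg .F + ιg .Q)
  | fq : Rel (ιg .F * ιg .Q) (ιg .Q * ιg .F)
  | hq : Rel (ιg .H * ιg .Q) (ιg .Q * ιg .H - ιg .Q)
  | pq : Rel (ιg .P * ιg .Q) (ιg .Q * ιg .P + ιg .Z)
  | ze : Rel (ιg .Z * ιg .E) (ιg .E * ιg .Z)
  | zh : Rel (ιg .Z * ιg .H) (ιg .H * ιg .Z)
  | zf : Rel (ιg .Z * ιg .F) (ιg .F * ιg .Z)
  | zp : Rel (ιg .Z * ιg .P) (ιg .P * ιg .Z)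
  | zq : Rel (ιg .Z * ιg .Q) (ιg .Q * ιg .Z)

/-- The universal enveloping algebra `U = U(s)` of the Schrödinger algebra,
presented by generators and relations (via the PBW theorem). -/
abbrev U : Type := RingQuot Rel

/-- The generators of `U`. -/
def gen (g : Gen) : U := RingQuot.mkAlgHom ℂ Rel (ιg g)

def E : U := gen .E
def H : U := gen .H
def F : U := gen .F
def P : U := gen .P
def Q : U := gen .Q
def Z : U := gen .Z

/-- Scalars inside `U`. -/
def sc (a : ℂ) : U := algebraMap ℂ U a

/-- The Casimir element `c = (h² + h + 4fe)z − 2(fp² − eq² − hpq)`. -/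
def cElt : U := (H * H + H + 4 * (F * E)) * Z - 2 * (F * (P * P) - E * (Q * Q) - H * (P * Q))

/-- The left ideal of `U` defining the Verma module `Δ(λ)` for
`λ ∈ 𝔥*` with `λ(h) = hh`, `λ(z) = zz`:  it is generated by `n₊ = span{e,p}`
together with `h - λ(h)` and `z - λ(z)`; then
`Δ(λ) = U ⊗_{U(𝔟)} ℂ_λ ≅ U / U(e, p, h - λ(h), z - λ(z))`. -/
def vermaIdeal (hh zz : ℂ) : Submodule U U :=
  Submodule.span U ({E, P, H - sc hh, Z - sc zz} : Set U)

/-- The Verma module `Δ(λ)` with highest weight `λ`, `λ(h) = hh`, `λ(z) = zz`. -/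
abbrev Verma (hh zz : ℂ) : Type := U ⧸ vermaIdeal hh zz

/-- The canonical highest weight generator `v_λ` of `Δ(λ)`. -/
def hwVec (hh zz : ℂ) : Verma hh zz := Submodule.Quotient.mk 1

/-- The unique maximal submodule `K(λ)` of `Δ(λ)`. -/
def vermaRad (hh zz : ℂ) : Submodule U (Verma hh zz) := sSup {N : Submodule U (Verma hh zz) | N ≠ ⊤}

/-- The simple highest weight module `L(λ) = Δ(λ)/K(λ)`. -/
abbrev SimpleHW (hh zz : ℂ) : Type := Verma hh zz ⧸ vermaRad hh zz

/-- The scalar `ϑ_λ = (λ(h)² + 3λ(h) + 2)·λ(z)` by which the Casimir element `c`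
acts on the Verma module `Δ(λ)`. -/
def vartheta (hh zz : ℂ) : ℂ := (hh ^ 2 + 3 * hh + 2) * zz

end

end Schrodinger

namespace Schrodinger

section Relations

variable {M : Type*} [AddCommGroup M] [Module U M]

lemma E_smul_F_smul (x : M) : E • F • x = F • E • x + H • x := by
  have h := RingQuot.mkAlgHom_rel ℂ Rel.ef
  simp only [map_mul, map_add] at h
  have h' : E * F = F * E + H := h
  rw [← mul_smul, h', add_smul, mul_smul]

lemma H_smul_F_smul [Module ℂ M] (x : M) : H • F • x = F • H • x - (2 : ℂ) • F • x := by
  have h := RingQuot.mkAlgHom_rel ℂ Rel.hf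
  simp only [map_mul, map_sub, map_ofNat] at h
  have h' : H * F = F * H - 2 * F := h
  rw [← mul_smul, h', sub_smul, mul_smul, two_mul, add_smul, two_smul]

lemma E_smul_Q_smul (x : M) : E • Q • x = Q • E • x + P • x := by
  have h := RingQuot.mkAlgHom_rel ℂ Rel.eq
  simp only [map_mul, map_add] at h
  have h' : E * Q = Q * E + P := h
  rw [← mul_smul, h', add_smul, mul_smul]

lemma E_smul_P_smul (x : M) : E • P • x = P • E • x := by
  have h := RingQuot.mkAlgHom_rel ℂ Rel.ep
  simp only [map_mul] at h
  have h' : E * P = P * E := h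
  rw [← mul_smul, h', mul_smul]

lemma F_smul_P_smul (x : M) : F • P • x = P • F • x + Q • x := by
  have h := RingQuot.mkAlgHom_rel ℂ Rel.fp
  simp only [map_mul, map_add] at h
  have h' : F * P = P * F + Q := h
  rw [← mul_smul, h', add_smul, mul_smul]

lemma F_smul_Q_smul (x : M) : F • Q • x = Q • F • x := by
  have h := RingQuot.mkAlgHom_rel ℂ Rel.fq
  simp only [map_mul] at h
  have h' : F * Q = Q * F := h
  rw [← mul_smul, h', mul_smul]

lemma H_smul_Q_smul (x : M) : H • Q • x = Q • H • x - Q • x := by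
  have h := RingQuot.mkAlgHom_rel ℂ Rel.hq
  simp only [map_mul, map_sub] at h
  have h' : H * Q = Q * H - Q := h
  rw [← mul_smul, h', sub_smul, mul_smul]

lemma P_smul_Q_smul (x : M) : P • Q • x = Q • P • x + Z • x := by
  have h := RingQuot.mkAlgHom_rel ℂ Rel.pq
  simp only [map_mul, map_add] at h
  have h' : P * Q = Q * P + Z := h
  rw [← mul_smul, h', add_smul, mul_smul]

/-- An element of `U` lies in a subalgebra containing the generators. -/
lemma mem_of_gen_mem (S : Subalgebra ℂ U) (hS : ∀ g, gen g ∈ S) (u : U) : u ∈ S := by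
  obtain ⟨a, rfl⟩ := RingQuot.mkAlgHom_surjective ℂ Rel u
  induction a using FreeAlgebra.induction with
  | grade0 r => rw [AlgHom.commutes]; exact S.algebraMap_mem r
  | grade1 g => exact hS g
  | mul a b ha hb => rw [map_mul]; exact S.mul_mem ha hb
  | add a b ha hb => rw [map_add]; exact S.add_mem ha hb

lemma mkAlgHom_rel_mul {a b c d : FA} (h : Rel (a * b) (c * d)) :
    RingQuot.mkAlgHom ℂ Rel a * RingQuot.mkAlgHom ℂ Rel b =
      RingQuot.mkAlgHom ℂ Rel c * RingQuot.mkAlgHom ℂ Rel d := by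
  rw [← map_mul, ← map_mul, RingQuot.mkAlgHom_rel ℂ h]

lemma Z_mul_comm (u : U) : Z * u = u * Z := by
  have key : u ∈ Subalgebra.centralizer ℂ ({Z} : Set U) := by
    refine mem_of_gen_mem _ (fun g => ?_) u
    rw [Subalgebra.mem_centralizer_iff]
    rintro _ rfl
    cases g with
    | E => exact mkAlgHom_rel_mul Rel.ze
    | H => exact mkAlgHom_rel_mul Rel.zh
    | F => exact mkAlgHom_rel_mul Rel.zf
    | P => exact mkAlgHom_rel_mul Rel.zp
    | Q => exact mkAlgHom_rel_mul Rel.zq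
    | Z => rfl
  exact (Subalgebra.mem_centralizer_iff ℂ).1 key Z rfl

end Relations

/-- Iterating an operator which lowers the index of a sequence of vectors. -/
lemma pow_apply_of_lowering {M : Type*} [AddCommGroup M] [Module ℂ M] (T : Module.End ℂ M)
    (w : ℕ → M) (s : ℕ → ℂ) (hT : ∀ n, T (w n) = s n • w (n - 1)) (a n : ℕ) :
    (T ^ a) (w n) = (∏ k ∈ Finset.range a, s (n - k)) • w (n - a) := by
  induction a with
  | zero => simp
  | succ a ih =>
    rw [pow_succ', Module.End.mul_apply, ih, map_smul, hT, smul_smul, Finset.prod_range_succ,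
      Nat.sub_sub]

noncomputable section HighestWeight

/-- The lowering operator `f + q²/(2z)`, which commutes with the Heisenberg part. -/
def loweringElt (zz : ℂ) : U := F + (2 * zz)⁻¹ • (Q * Q)

/-- The raising operator `e - p²/(2z)`, which commutes with the Heisenberg part. -/
def raisingElt (zz : ℂ) : U := E - (2 * zz)⁻¹ • (P * P)

variable {M : Type*} [AddCommGroup M] [Module U M]

/-- The vectors `(f + q²/(2z))ⁱ qʲ v`. -/
def descendant (zz : ℂ) (v : M) (i j : ℕ) : M := loweringElt zz ^ i • Q ^ j • v

lemma descendant_succ (zz : ℂ) (v : M) (i j : ℕ) :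
    descendant zz v (i + 1) j = loweringElt zz • descendant zz v i j := by
  rw [descendant, descendant, pow_succ', mul_smul]

lemma descendant_zero_succ (zz : ℂ) (v : M) (j : ℕ) :
    descendant zz v 0 (j + 1) = Q • descendant zz v 0 j := by
  simp only [descendant, pow_zero, one_smul, pow_succ', mul_smul]

lemma descendant_zero_zero (zz : ℂ) (v : M) : descendant zz v 0 0 = v := by
  simp [descendant]

variable [Module ℂ M] [IsScalarTower ℂ U M]

lemma loweringElt_smul (zz : ℂ) (x : M) :
    loweringElt zz • x = F • x + (2 * zz)⁻¹ • Q • Q • x := by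
  rw [loweringElt, add_smul, smul_assoc, mul_smul]

lemma raisingElt_smul (zz : ℂ) (x : M) :
    raisingElt zz • x = E • x - (2 * zz)⁻¹ • P • P • x := by
  rw [raisingElt, sub_smul, smul_assoc, mul_smul]

lemma Q_smul_descendant (zz : ℂ) (v : M) (i j : ℕ) :
    Q • descendant zz v i j = descendant zz v i (j + 1) := by
  induction i with
  | zero => rw [descendant_zero_succ]
  | succ i ih =>
    rw [descendant_succ, descendant_succ, ← ih]
    simp only [loweringElt_smul, smul_add, F_smul_Q_smul, smul_comm Q ((2 * zz)⁻¹)]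

lemma F_smul_descendant (zz : ℂ) (v : M) (i j : ℕ) :
    F • descendant zz v i j =
      descendant zz v (i + 1) j - (2 * zz)⁻¹ • descendant zz v i (j + 2) := by
  rw [descendant_succ, loweringElt_smul, Q_smul_descendant, Q_smul_descendant, add_sub_cancel_right]

lemma H_smul_descendant {hh : ℂ} (zz : ℂ) {v : M} (hv : H • v = hh • v) (i j : ℕ) :
    H • descendant zz v i j = (hh - 2 * i - j) • descendant zz v i j := by
  induction i with
  | zero =>
    induction j with
    | zero => simp [descendant_zero_zero, hv]
    | succ j ih =>
      rw [descendant_zero_succ, H_smul_Q_smul, ih, smul_comm Q]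
      generalize Q • descendant zz v 0 j = y
      push_cast
      module
  | succ i ih =>
    rw [descendant_succ]
    simp only [loweringElt_smul, smul_add, smul_sub, smul_comm H ((2 * zz)⁻¹), H_smul_F_smul,
      H_smul_Q_smul, ih, smul_comm Q (_ : ℂ), smul_comm F (_ : ℂ)]
    generalize F • descendant zz v i j = y
    generalize Q • Q • descendant zz v i j = y'
    push_cast
    module

variable {zz : ℂ}

lemma P_smul_loweringElt_smul (hzz : zz ≠ 0) (hZ : ∀ x : M, Z • x = zz • x) (x : M) :
    P • loweringElt zz • x = loweringElt zz • P • x := by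
  simp only [loweringElt_smul, smul_add, smul_comm P ((2 * zz)⁻¹), F_smul_P_smul, P_smul_Q_smul,
    hZ, smul_comm Q zz]
  generalize P • F • x = a
  generalize Q • Q • P • x = b
  generalize Q • x = y
  match_scalars <;> field_simp
  all_goals ring

lemma P_smul_descendant (hzz : zz ≠ 0) (hZ : ∀ x : M, Z • x = zz • x) {v : M} (hv : P • v = 0)
    (i j : ℕ) : P • descendant zz v i j = (zz * j) • descendant zz v i (j - 1) := by
  induction i with
  | zero =>
    induction j with
    | zero => simp [descendant_zero_zero, hv]
    | succ j ih =>
      rw [descendant_zero_succ, P_smul_Q_smul, ih, hZ, smul_comm Q, Q_smul_descendant]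
      cases j with
      | zero => simp
      | succ j =>
        simp only [Nat.add_sub_cancel]
        push_cast
        module
  | succ i ih =>
    rw [descendant_succ, P_smul_loweringElt_smul hzz hZ, ih, descendant_succ,
      smul_comm (loweringElt zz)]

lemma raisingElt_smul_Q_smul (hzz : zz ≠ 0) (hZ : ∀ x : M, Z • x = zz • x) (x : M) :
    raisingElt zz • Q • x = Q • raisingElt zz • x := by
  simp only [raisingElt_smul, smul_add, smul_sub, smul_comm Q ((2 * zz)⁻¹), E_smul_Q_smul,
    P_smul_Q_smul, hZ, smul_comm P zz]
  generalize Q • E • x = a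
  generalize Q • P • P • x = b
  generalize P • x = y
  match_scalars <;> field_simp
  all_goals ring

lemma raisingElt_smul_loweringElt_smul (hzz : zz ≠ 0) (hZ : ∀ x : M, Z • x = zz • x) (x : M) :
    raisingElt zz • loweringElt zz • x =
      loweringElt zz • raisingElt zz • x + H • x + zz⁻¹ • Q • P • x + (2⁻¹ : ℂ) • x := by
  have h : raisingElt zz • F • x =
      F • raisingElt zz • x + H • x + zz⁻¹ • Q • P • x + (2⁻¹ : ℂ) • x := by
    have hPF (y : M) : P • F • y = F • P • y - Q • y := by rw [F_smul_P_smul]; abel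
    simp only [raisingElt_smul, smul_sub, smul_add, E_smul_F_smul, hPF, P_smul_Q_smul,
      hZ, smul_comm F ((2 * zz)⁻¹)]
    generalize F • E • x = a
    generalize F • P • P • x = b
    generalize H • x = y
    generalize Q • P • x = y'
    match_scalars <;> field_simp
    all_goals ring
  rw [loweringElt_smul, smul_add, smul_comm (raisingElt zz) ((2 * zz)⁻¹), h,
    raisingElt_smul_Q_smul hzz hZ, raisingElt_smul_Q_smul hzz hZ, loweringElt_smul]
  abel

lemma raisingElt_smul_descendant (hzz : zz ≠ 0) (hZ : ∀ x : M, Z • x = zz • x) {hh : ℂ} {v : M}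
    (hE : E • v = 0) (hP : P • v = 0) (hH : H • v = hh • v) (i j : ℕ) :
    raisingElt zz • descendant zz v i j =
      (i * (hh + 3 / 2 - i)) • descendant zz v (i - 1) j := by
  induction i with
  | zero =>
    induction j with
    | zero => simp [descendant_zero_zero, raisingElt_smul, hE, hP]
    | succ j ih =>
      rw [descendant_zero_succ, raisingElt_smul_Q_smul hzz hZ, ih]
      simp
  | succ i ih =>
    have hQP : Q • P • descendant zz v i j = (zz * j) • descendant zz v i j := by
      rw [P_smul_descendant hzz hZ hP, smul_comm Q, Q_smul_descendant]
      cases j <;> simp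
    have hL : loweringElt zz • raisingElt zz • descendant zz v i j =
        (i * (hh + 3 / 2 - i)) • descendant zz v i j := by
      rw [ih, smul_comm (loweringElt zz), ← descendant_succ]
      cases i <;> simp
    rw [descendant_succ, raisingElt_smul_loweringElt_smul hzz hZ, hL, hQP,
      H_smul_descendant zz hH, Nat.add_sub_cancel]
    push_cast
    match_scalars
    field_simp
    ring

/-- The vectors `(f + q²/(2z))ⁱ qʲ v` span the submodule generated by a highest weight vector. -/
lemma smul_mem_span_descendant (hzz : zz ≠ 0) (hZ : ∀ x : M, Z • x = zz • x) {hh : ℂ} {v : M}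
    (hE : E • v = 0) (hP : P • v = 0) (hH : H • v = hh • v) (u : U) :
    u • v ∈ Submodule.span ℂ (Set.range fun ij : ℕ × ℕ => descendant zz v ij.1 ij.2) := by
  set S := Submodule.span ℂ (Set.range fun ij : ℕ × ℕ => descendant zz v ij.1 ij.2)
  have hw (i j : ℕ) : descendant zz v i j ∈ S := Submodule.subset_span ⟨(i, j), rfl⟩
  have hmem : ∀ x ∈ S, u • x ∈ S := by
    let A : Subalgebra ℂ U :=
      { carrier := {u | ∀ x ∈ S, u • x ∈ S}
        mul_mem' := fun {a b} ha hb x hx => by rw [mul_smul]; exact ha _ (hb _ hx)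
        add_mem' := fun {a b} ha hb x hx => by rw [add_smul]; exact S.add_mem (ha _ hx) (hb _ hx)
        algebraMap_mem' := fun r x hx => by rw [algebraMap_smul]; exact S.smul_mem r hx }
    refine mem_of_gen_mem A (fun g x hx => ?_) u
    suffices h : S ≤ S.comap (Algebra.lsmul ℂ ℂ M (gen g)) from h hx
    refine Submodule.span_le.2 ?_
    rintro _ ⟨⟨i, j⟩, rfl⟩
    change gen g • descendant zz v i j ∈ S
    cases g with
    | E =>
      have h : E • descendant zz v i j = raisingElt zz • descendant zz v i j +
          (2 * zz)⁻¹ • P • P • descendant zz v i j := by rw [raisingElt_smul, sub_add_cancel]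
      change E • _ ∈ S
      rw [h, raisingElt_smul_descendant hzz hZ hE hP hH, P_smul_descendant hzz hZ hP,
        smul_comm P, P_smul_descendant hzz hZ hP]
      exact S.add_mem (S.smul_mem _ (hw _ _))
        (S.smul_mem _ (S.smul_mem _ (S.smul_mem _ (hw _ _))))
    | H =>
      change H • _ ∈ S
      rw [H_smul_descendant zz hH]
      exact S.smul_mem _ (hw _ _)
    | F =>
      change F • _ ∈ S
      rw [F_smul_descendant]
      exact S.sub_mem (hw _ _) (S.smul_mem _ (hw _ _))
    | P =>
      change P • _ ∈ S
      rw [P_smul_descendant hzz hZ hP]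
      exact S.smul_mem _ (hw _ _)
    | Q =>
      change Q • _ ∈ S
      rw [Q_smul_descendant]
      exact hw _ _
    | Z =>
      change Z • _ ∈ S
      rw [hZ]
      exact S.smul_mem _ (hw _ _)
  have hv : v ∈ S := by simpa only [descendant_zero_zero] using hw 0 0
  exact hmem v hv

/-- A nonzero highest weight module of non-half-integral weight and nonzero central charge is
simple. -/
theorem isSimpleModule_of_highestWeight [Nontrivial M] (hzz : zz ≠ 0)
    (hZ : ∀ x : M, Z • x = zz • x) {hh : ℂ} (hhh : ∀ k : ℤ, hh ≠ (k : ℂ) / 2) {v : M}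
    (hE : E • v = 0) (hP : P • v = 0) (hH : H • v = hh • v) (hgen : ∀ x : M, ∃ u : U, u • v = x) :
    IsSimpleModule U M := by
  refine { eq_bot_or_eq_top := fun N => or_iff_not_imp_left.2 fun hN => ?_ }
  suffices hvN : v ∈ N by
    refine (Submodule.eq_top_iff').2 fun x => ?_
    obtain ⟨u, rfl⟩ := hgen x
    exact N.smul_mem u hvN
  obtain ⟨x, hxN, hx⟩ := N.ne_bot_iff.1 hN
  obtain ⟨u, rfl⟩ := hgen x
  obtain ⟨c, hc⟩ := Finsupp.mem_span_range_iff_exists_finsupp.1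
    (smul_mem_span_descendant hzz hZ hE hP hH u)
  have hc0 : c.support.Nonempty := by
    rw [Finsupp.support_nonempty_iff]
    rintro rfl
    exact hx (by simpa using hc.symm)
  obtain ⟨⟨a, b⟩, hab, hmax⟩ := c.support.exists_max_image (fun ij => ij.1 + ij.2) hc0
  let sE : ℕ → ℂ := fun n => n * (hh + 3 / 2 - n)
  let sP : ℕ → ℂ := fun n => zz * n
  have hlower (i j : ℕ) : (raisingElt zz ^ a * P ^ b) • descendant zz v i j =
      ((∏ k ∈ Finset.range a, sE (i - k)) * ∏ k ∈ Finset.range b, sP (j - k)) •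
        descendant zz v (i - a) (j - b) := by
    have h₁ := pow_apply_of_lowering (Algebra.lsmul ℂ ℂ M P) (descendant zz v i) sP
      (fun n => P_smul_descendant hzz hZ hP i n) b j
    have h₂ := pow_apply_of_lowering (Algebra.lsmul ℂ ℂ M (raisingElt zz))
      (fun n => descendant zz v n (j - b)) sE
      (fun n => raisingElt_smul_descendant hzz hZ hE hP hH n (j - b)) a i
    rw [← map_pow, Algebra.lsmul_coe] at h₁ h₂
    beta_reduce at h₁ h₂
    rw [mul_smul, h₁, smul_comm, h₂, smul_smul, mul_comm]
  have hsE0 : sE 0 = 0 := by simp [sE]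
  have hsP0 : sP 0 = 0 := by simp [sP]
  have hsE (n : ℕ) (hn : n ≠ 0) : sE n ≠ 0 := by
    refine mul_ne_zero (Nat.cast_ne_zero.2 hn) fun h => hhh (2 * n - 3) ?_
    push_cast
    linear_combination h
  have hsP (n : ℕ) (hn : n ≠ 0) : sP n ≠ 0 := mul_ne_zero hzz (Nat.cast_ne_zero.2 hn)
  have hcoef : c (a, b) * ((∏ k ∈ Finset.range a, sE (a - k)) *
      ∏ k ∈ Finset.range b, sP (b - k)) ≠ 0 := by
    refine mul_ne_zero (Finsupp.mem_support_iff.1 hab) (mul_ne_zero ?_ ?_)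
    · refine Finset.prod_ne_zero_iff.2 fun k hk => hsE _ ?_
      have := Finset.mem_range.1 hk
      omega
    · refine Finset.prod_ne_zero_iff.2 fun k hk => hsP _ ?_
      have := Finset.mem_range.1 hk
      omega
  have hv : (raisingElt zz ^ a * P ^ b) • u • v = (c (a, b) * ((∏ k ∈ Finset.range a, sE (a - k)) *
      ∏ k ∈ Finset.range b, sP (b - k))) • v := by
    rw [← hc, Finsupp.sum, Finset.smul_sum, Finset.sum_eq_single (a, b)]
    · rw [smul_comm, hlower, Nat.sub_self, Nat.sub_self, descendant_zero_zero, smul_smul]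
    · rintro ⟨i, j⟩ hij hne
      have hle : i + j ≤ a + b := hmax _ hij
      rw [smul_comm, hlower]
      rcases lt_or_ge i a with hi | hi
      · rw [Finset.prod_eq_zero (Finset.mem_range.2 hi) (by rw [Nat.sub_self, hsE0]), zero_mul,
          zero_smul, smul_zero]
      · have hj : j < b := by
          by_contra! hj
          exact hne (Prod.ext (by simp only; omega) (by simp only; omega))
        rw [Finset.prod_eq_zero (Finset.mem_range.2 hj) (by rw [Nat.sub_self, hsP0]), mul_zero,
          zero_smul, smul_zero]
    · exact fun h => absurd hab h
  have hmem := N.smul_of_tower_mem (c (a, b) * ((∏ k ∈ Finset.range a, sE (a - k)) *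
      ∏ k ∈ Finset.range b, sP (b - k)))⁻¹ (N.smul_mem (raisingElt zz ^ a * P ^ b) hxN)
  rwa [hv, inv_smul_smul₀ hcoef] at hmem

end HighestWeight

noncomputable section Model

/-- The action of the generators on the model `ℕ → ℕ → ℂ` of a highest weight module, whose
entry at `(i, j)` is the (rescaled) coefficient of `(f + q²/(2z))ⁱ qʲ v`. -/
def modelGen (hh zz : ℂ) : Gen → Module.End ℂ (ℕ → ℕ → ℂ)
  | .E =>
    { toFun := fun g i j => (hh + 1 / 2 - i) * g (i + 1) j + zz / 2 * g i (j + 2)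
      map_add' := fun _ _ => by ext; simp only [Pi.add_apply]; ring
      map_smul' := fun _ _ => by
        ext; simp only [Pi.smul_apply, smul_eq_mul, RingHom.id_apply]; ring }
  | .H =>
    { toFun := fun g i j => (hh - 2 * i - j) * g i j
      map_add' := fun _ _ => by ext; simp only [Pi.add_apply]; ring
      map_smul' := fun _ _ => by
        ext; simp only [Pi.smul_apply, smul_eq_mul, RingHom.id_apply]; ring }
  | .F =>
    { toFun := fun g i j => i * g (i - 1) j - j * (j - 1) / (2 * zz) * g i (j - 2)
      map_add' := fun _ _ => by ext; simp only [Pi.add_apply]; ring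
      map_smul' := fun _ _ => by
        ext; simp only [Pi.smul_apply, smul_eq_mul, RingHom.id_apply]; ring }
  | .P =>
    { toFun := fun g i j => zz * g i (j + 1)
      map_add' := fun _ _ => by ext; simp only [Pi.add_apply]; ring
      map_smul' := fun _ _ => by
        ext; simp only [Pi.smul_apply, smul_eq_mul, RingHom.id_apply]; ring }
  | .Q =>
    { toFun := fun g i j => j * g i (j - 1)
      map_add' := fun _ _ => by ext; simp only [Pi.add_apply]; ring
      map_smul' := fun _ _ => by
        ext; simp only [Pi.smul_apply, smul_eq_mul, RingHom.id_apply]; ring }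
  | .Z => zz • LinearMap.id

section

variable (hh zz : ℂ) (g : ℕ → ℕ → ℂ) (i j : ℕ)

lemma modelGen_E_apply : modelGen hh zz .E g i j =
    (hh + 1 / 2 - i) * g (i + 1) j + zz / 2 * g i (j + 2) := rfl

lemma modelGen_H_apply : modelGen hh zz .H g i j = (hh - 2 * i - j) * g i j := rfl

lemma modelGen_F_apply : modelGen hh zz .F g i j =
    i * g (i - 1) j - j * (j - 1) / (2 * zz) * g i (j - 2) := rfl

lemma modelGen_P_apply : modelGen hh zz .P g i j = zz * g i (j + 1) := rfl

lemma modelGen_Q_apply : modelGen hh zz .Q g i j = j * g i (j - 1) := rfl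

lemma modelGen_Z_apply : modelGen hh zz .Z g i j = zz * g i j := rfl

end

lemma lift_modelGen_rel (hh : ℂ) {zz : ℂ} (hzz : zz ≠ 0) ⦃a b : FA⦄ (h : Rel a b) :
    FreeAlgebra.lift ℂ (modelGen hh zz) a = FreeAlgebra.lift ℂ (modelGen hh zz) b := by
  cases h <;>
  · simp only [ιg, map_mul, map_add, map_sub, FreeAlgebra.lift_ι_apply, two_mul]
    refine LinearMap.ext fun g => funext fun i => funext fun j => ?_
    simp only [Module.End.mul_apply, LinearMap.add_apply, LinearMap.sub_apply, Pi.add_apply,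
      Pi.sub_apply, modelGen_E_apply, modelGen_H_apply, modelGen_F_apply, modelGen_P_apply,
      modelGen_Q_apply, modelGen_Z_apply]
    all_goals rcases i with _ | i <;> rcases j with _ | _ | _ | j
    all_goals
      try simp only [Nat.add_sub_cancel, Nat.zero_sub, Nat.add_assoc, Nat.reduceAdd, Nat.reduceSub,
        Nat.reduceSubDiff, zero_add]
      try push_cast
      try field_simp
      try ring

/-- The representation of `U` on the model. -/
def modelRep (hh : ℂ) {zz : ℂ} (hzz : zz ≠ 0) : U →ₐ[ℂ] Module.End ℂ (ℕ → ℕ → ℂ) :=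
  RingQuot.liftAlgHom ℂ ⟨FreeAlgebra.lift ℂ (modelGen hh zz), lift_modelGen_rel hh hzz⟩

lemma modelRep_gen (hh : ℂ) {zz : ℂ} (hzz : zz ≠ 0) (g : Gen) :
    modelRep hh hzz (gen g) = modelGen hh zz g := by
  rw [modelRep, gen, RingQuot.liftAlgHom_mkAlgHom_apply, ιg, FreeAlgebra.lift_ι_apply]

lemma nontrivial_verma (hh : ℂ) {zz : ℂ} (hzz : zz ≠ 0) : Nontrivial (Verma hh zz) := by
  rw [Submodule.Quotient.nontrivial_iff, Ne, Ideal.eq_top_iff_one]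
  intro h1
  let v : ℕ → ℕ → ℂ := Pi.single 0 (Pi.single 0 1)
  have hann (u : U) (hu : u ∈ vermaIdeal hh zz) : modelRep hh hzz u v = 0 := by
    induction hu using Submodule.span_induction with
    | mem u hu =>
      rcases hu with rfl | rfl | rfl | rfl
      · rw [E, modelRep_gen]
        ext i j
        rcases i with _ | i <;> simp [modelGen, v]
      · rw [P, modelRep_gen]
        ext i j
        rcases i with _ | i <;> simp [modelGen, v]
      · rw [H, sc, map_sub, modelRep_gen, AlgHom.commutes]
        ext i j
        rcases i with _ | i <;> rcases j with _ | j <;> simp [modelGen, v]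
      · rw [Z, sc, map_sub, modelRep_gen, AlgHom.commutes]
        ext i j
        simp [modelGen]
    | zero => simp
    | add a b _ _ ha hb => rw [map_add, LinearMap.add_apply, ha, hb, add_zero]
    | smul a b _ hb => rw [smul_eq_mul, map_mul, Module.End.mul_apply, hb, map_zero]
  have h := congrFun (congrFun (hann 1 h1) 0) 0
  simp [v] at h

end Model

lemma hwVec_smul_eq_zero {hh zz : ℂ} {u : U} (hu : u ∈ vermaIdeal hh zz) :
    u • hwVec hh zz = 0 := by
  rw [hwVec, ← Submodule.Quotient.mk_smul, smul_eq_mul, mul_one]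
  exact (Submodule.Quotient.mk_eq_zero _).2 hu

lemma exists_smul_hwVec (hh zz : ℂ) (x : Verma hh zz) : ∃ u : U, u • hwVec hh zz = x := by
  obtain ⟨u, rfl⟩ := Submodule.Quotient.mk_surjective _ x
  exact ⟨u, by rw [hwVec, ← Submodule.Quotient.mk_smul, smul_eq_mul, mul_one]⟩

/-- Proposition 3(i) of the paper: if `λ(z) ≠ 0` and
`λ(h) ∉ ½ℤ`, then the Verma module `Δ(λ)` is a simple `U`-module. -/
theorem verma_simple_of_nonzero_charge_of_not_half_integral (hh zz : ℂ)
    (hzz : zz ≠ 0) (hhh : ∀ k : ℤ, hh ≠ (k : ℂ) / 2) :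
    IsSimpleModule U (Verma hh zz) := by
  have hH : H • hwVec hh zz = hh • hwVec hh zz := by
    have h : (H - sc hh) • hwVec hh zz = 0 :=
      hwVec_smul_eq_zero (Submodule.subset_span (by simp))
    rwa [sub_smul, sc, algebraMap_smul, sub_eq_zero] at h
  have hZ : Z • hwVec hh zz = zz • hwVec hh zz := by
    have h : (Z - sc zz) • hwVec hh zz = 0 :=
      hwVec_smul_eq_zero (Submodule.subset_span (by simp))
    rwa [sub_smul, sc, algebraMap_smul, sub_eq_zero] at h
  have := nontrivial_verma hh hzz
  refine isSimpleModule_of_highestWeight hzz (fun x => ?_) hhh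
    (hwVec_smul_eq_zero (Submodule.subset_span (by simp)))
    (hwVec_smul_eq_zero (Submodule.subset_span (by simp))) hH (exists_smul_hwVec hh zz)
  obtain ⟨u, rfl⟩ := exists_smul_hwVec hh zz x
  rw [← mul_smul, Z_mul_comm, mul_smul, hZ, smul_comm]

end Schrodinger
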